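/- arXiv:2209.02433 — 2 statements merged into one kernel-verified Lean document; each statement's English description precedes it below -/
import Mathlib

section
/- Let p = (p_i)_{i∈I} ∈ ℕ^I, let h ∈ I, and let i = (i_1,…,i_ν) ∈ ℐ with associated coefficients r_{h,k}. Let (b_{ij})_{i,j∈I} be the inverse of the Cartan matrix (a_{ij}) (a matrix with nonnegative rational entries), and let i ↦ i^! be the involution of I determined by s_{i^!} = w₀ s_i w₀. Then Σ_{k=1}^{ν} r_{h,k} · p_{i_k} = Σ_{i∈I} (p_i + p_{i^!}) · b_{ih}, an equality in ℚ (the left-hand side being a nonnegative integer). -/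
open scoped BigOperators

namespace Lusztig

variable {I : Type*} [Fintype I] [DecidableEq I]

/-- A simply laced Cartan matrix: symmetric, positive definite, integer entries,
`2` on the diagonal and `0` or `-1` off the diagonal. -/
structure IsSimplyLacedCartan (A : Matrix I I ℤ) : Prop where
  symm : ∀ i j, A i j = A j i
  posDef : ∀ x : I → ℤ, x ≠ 0 → 0 < ∑ i, ∑ j, x i * A i j * x j
  diag : ∀ i, A i i = 2
  offDiag : ∀ i j, i ≠ j → A i j = 0 ∨ A i j = -1

/-- The simple reflection `s_i` acting on `ℤ[I] = I → ℤ`, `s_i(j') = j' - a_{ij} i'`. -/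
def sE (A : Matrix I I ℤ) (i : I) : Function.End (I → ℤ) :=
  fun x => x - (∑ j, A i j * x j) • Pi.single i 1

/-- The length of `w`: the least `n` such that `w` is a product of `n` simple
reflections (`∞` convention: `sInf ∅ = 0`). -/
noncomputable def len (A : Matrix I I ℤ) (w : Function.End (I → ℤ)) : ℕ :=
  sInf {n | ∃ l : List I, l.length = n ∧ (l.map (sE A)).prod = w}

/-- `w₀` is the longest element of `W = ⟨s_i⟩` and `ν = |w₀|`. -/
structure IsLongest (A : Matrix I I ℤ) (w₀ : Function.End (I → ℤ)) (ν : ℕ) : Prop where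
  mem : ∃ l : List I, (l.map (sE A)).prod = w₀
  len_eq : len A w₀ = ν
  longest : ∀ w : Function.End (I → ℤ),
    (∃ l : List I, (l.map (sE A)).prod = w) → len A w ≤ ν

/-- `ℐ`: the set of sequences `(i_1, …, i_ν)` with `s_{i_1} ⋯ s_{i_ν} = w₀`. -/
def RedWord (A : Matrix I I ℤ) (w₀ : Function.End (I → ℤ)) (ν : ℕ) :
    Set (Fin ν → I) :=
  {f | ((List.ofFn f).map (sE A)).prod = w₀}

/-- The coefficient `r_{h,k}` defined by
`s_{i_1} ⋯ s_{i_{k-1}} (i_k') = Σ_h r_{h,k} h'` (here `k` is `0`-indexed). -/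
def rCoef (A : Matrix I I ℤ) {ν : ℕ} (f : Fin ν → I) (h : I) (k : Fin ν) : ℤ :=
  ((List.ofFn fun m : Fin (k : ℕ) => sE A (f (Fin.castLE k.2.le m))).prod :
    Function.End (I → ℤ)) (Pi.single (f k) 1) h

/-- `‖i,a‖_h = Π_k a_k^{r_{h,k}}`. -/
def normAt (A : Matrix I I ℤ) {ν : ℕ} {K : Type*} [CommGroup K]
    (f : Fin ν → I) (a : Fin ν → K) (h : I) : K :=
  ∏ k : Fin ν, a k ^ rCoef A f h k

section Semifield

variable {K : Type*} [CommGroup K] [AddCommSemigroup K]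

/-- Adjacency of two pairs in `ℐ × K^ν`, for a semifield `K` (written
multiplicatively, with addition `+`). -/
def Adjacent (A : Matrix I I ℤ) (w₀ : Function.End (I → ℤ)) (ν : ℕ)
    (p q : (Fin ν → I) × (Fin ν → K)) : Prop :=
  p.1 ∈ RedWord A w₀ ν ∧ q.1 ∈ RedWord A w₀ ν ∧
  ((∃ (l : ℕ) (h0 : l < ν) (h1 : l + 1 < ν) (h2 : l + 2 < ν),
      A (p.1 ⟨l, h0⟩) (p.1 ⟨l + 1, h1⟩) = -1 ∧
      p.1 ⟨l + 2, h2⟩ = p.1 ⟨l, h0⟩ ∧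
      q.1 ⟨l, h0⟩ = p.1 ⟨l + 1, h1⟩ ∧ q.1 ⟨l + 1, h1⟩ = p.1 ⟨l, h0⟩ ∧
      q.1 ⟨l + 2, h2⟩ = p.1 ⟨l + 1, h1⟩ ∧
      (∀ k : Fin ν, (k : ℕ) ≠ l → (k : ℕ) ≠ l + 1 → (k : ℕ) ≠ l + 2 →
        q.1 k = p.1 k ∧ q.2 k = p.2 k) ∧
      q.2 ⟨l, h0⟩ =
        p.2 ⟨l + 1, h1⟩ * p.2 ⟨l + 2, h2⟩ * (p.2 ⟨l, h0⟩ + p.2 ⟨l + 2, h2⟩)⁻¹ ∧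
      q.2 ⟨l + 1, h1⟩ = p.2 ⟨l, h0⟩ + p.2 ⟨l + 2, h2⟩ ∧
      q.2 ⟨l + 2, h2⟩ =
        p.2 ⟨l, h0⟩ * p.2 ⟨l + 1, h1⟩ * (p.2 ⟨l, h0⟩ + p.2 ⟨l + 2, h2⟩)⁻¹) ∨
   (∃ (l : ℕ) (h0 : l < ν) (h1 : l + 1 < ν),
      A (p.1 ⟨l, h0⟩) (p.1 ⟨l + 1, h1⟩) = 0 ∧
      q.1 ⟨l, h0⟩ = p.1 ⟨l + 1, h1⟩ ∧ q.1 ⟨l + 1, h1⟩ = p.1 ⟨l, h0⟩ ∧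
      (∀ k : Fin ν, (k : ℕ) ≠ l → (k : ℕ) ≠ l + 1 →
        q.1 k = p.1 k ∧ q.2 k = p.2 k) ∧
      q.2 ⟨l, h0⟩ = p.2 ⟨l + 1, h1⟩ ∧ q.2 ⟨l + 1, h1⟩ = p.2 ⟨l, h0⟩))

end Semifield

/-- Adjacency of two pairs in `ℐ × ℤ^ν` for the tropical semifield `ℤ`
(sum = `min`, product = `+`). -/
def TAdjacent (A : Matrix I I ℤ) (w₀ : Function.End (I → ℤ)) (ν : ℕ)
    (p q : (Fin ν → I) × (Fin ν → ℤ)) : Prop :=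
  p.1 ∈ RedWord A w₀ ν ∧ q.1 ∈ RedWord A w₀ ν ∧
  ((∃ (l : ℕ) (h0 : l < ν) (h1 : l + 1 < ν) (h2 : l + 2 < ν),
      A (p.1 ⟨l, h0⟩) (p.1 ⟨l + 1, h1⟩) = -1 ∧
      p.1 ⟨l + 2, h2⟩ = p.1 ⟨l, h0⟩ ∧
      q.1 ⟨l, h0⟩ = p.1 ⟨l + 1, h1⟩ ∧ q.1 ⟨l + 1, h1⟩ = p.1 ⟨l, h0⟩ ∧
      q.1 ⟨l + 2, h2⟩ = p.1 ⟨l + 1, h1⟩ ∧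
      (∀ k : Fin ν, (k : ℕ) ≠ l → (k : ℕ) ≠ l + 1 → (k : ℕ) ≠ l + 2 →
        q.1 k = p.1 k ∧ q.2 k = p.2 k) ∧
      q.2 ⟨l, h0⟩ =
        p.2 ⟨l + 1, h1⟩ + p.2 ⟨l + 2, h2⟩ - min (p.2 ⟨l, h0⟩) (p.2 ⟨l + 2, h2⟩) ∧
      q.2 ⟨l + 1, h1⟩ = min (p.2 ⟨l, h0⟩) (p.2 ⟨l + 2, h2⟩) ∧
      q.2 ⟨l + 2, h2⟩ =
        p.2 ⟨l, h0⟩ + p.2 ⟨l + 1, h1⟩ - min (p.2 ⟨l, h0⟩) (p.2 ⟨l + 2, h2⟩)) ∨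
   (∃ (l : ℕ) (h0 : l < ν) (h1 : l + 1 < ν),
      A (p.1 ⟨l, h0⟩) (p.1 ⟨l + 1, h1⟩) = 0 ∧
      q.1 ⟨l, h0⟩ = p.1 ⟨l + 1, h1⟩ ∧ q.1 ⟨l + 1, h1⟩ = p.1 ⟨l, h0⟩ ∧
      (∀ k : Fin ν, (k : ℕ) ≠ l → (k : ℕ) ≠ l + 1 →
        q.1 k = p.1 k ∧ q.2 k = p.2 k) ∧
      q.2 ⟨l, h0⟩ = p.2 ⟨l + 1, h1⟩ ∧ q.2 ⟨l + 1, h1⟩ = p.2 ⟨l, h0⟩))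

open Matrix

variable {A : Matrix I I ℤ}

/-- The simple reflection `sE A i` as a linear map. -/
def simpleRefl (A : Matrix I I ℤ) (i : I) : Module.End ℤ (I → ℤ) :=
  LinearMap.id - ((LinearMap.proj i).comp A.mulVecLin).smulRight (Pi.single i 1)

lemma simpleRefl_apply (i : I) (x : I → ℤ) :
    simpleRefl A i x = x - (A *ᵥ x) i • Pi.single i 1 := rfl

/-- The product of the simple reflections in a word. -/
def wordProd (A : Matrix I I ℤ) (l : List I) : Module.End ℤ (I → ℤ) :=
  (l.map (simpleRefl A)).prod

@[simp] lemma wordProd_nil : wordProd A [] = 1 := rfl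

@[simp] lemma wordProd_cons (i : I) (l : List I) :
    wordProd A (i :: l) = simpleRefl A i * wordProd A l := by simp [wordProd]

lemma wordProd_append (l m : List I) :
    wordProd A (l ++ m) = wordProd A l * wordProd A m := by simp [wordProd]

lemma coe_wordProd (l : List I) :
    (l.map (sE A)).prod = (⇑(wordProd A l) : Function.End (I → ℤ)) := by
  induction l with
  | nil => rfl
  | cons i l ih => rw [List.map_cons, List.prod_cons, ih, wordProd_cons]; rfl

lemma coe_wordProd_eq_iff {l m : List I} :
    (l.map (sE A)).prod = (m.map (sE A)).prod ↔ wordProd A l = wordProd A m := by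
  rw [coe_wordProd, coe_wordProd]
  exact DFunLike.coe_injective.eq_iff

/-- Telescoping: `x - s_{i_1} ⋯ s_{i_n} x` is the sum of the vectors
`s_{i_1} ⋯ s_{i_{k-1}} (i_k')` weighted by the entries of `A x`. -/
lemma sum_rCoef_mul_mulVec {n : ℕ} (f : Fin n → I) (h : I) (x : I → ℤ) :
    ∑ k, rCoef A f h k * (A *ᵥ x) (f k) = (x - wordProd A (List.ofFn f) x) h := by
  induction n with
  | zero => simp
  | succ n ih =>
    have hcast : ∀ k : Fin n,
        rCoef A f h k.castSucc = rCoef A (fun m : Fin n => f m.castSucc) h k := fun k => rfl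
    have hlast : rCoef A f h (Fin.last n) =
        wordProd A (List.ofFn fun m : Fin n => f m.castSucc) (Pi.single (f (Fin.last n)) 1) h := by
      have := coe_wordProd (A := A) (List.ofFn fun m : Fin n => f m.castSucc)
      rw [← this, List.map_ofFn]
      rfl
    rw [Fin.sum_univ_castSucc, List.ofFn_succ_last, wordProd_append]
    simp only [hcast, ih fun m : Fin n => f m.castSucc, hlast]
    simp only [wordProd_cons, wordProd_nil, mul_one, Module.End.mul_apply, simpleRefl_apply,
      map_sub, map_smul, Pi.sub_apply, Pi.smul_apply, smul_eq_mul]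
    ring

namespace IsSimplyLacedCartan

lemma pairing_comm {J : Type*} [Fintype J] {B : Matrix J J ℤ}
    (hB : IsSimplyLacedCartan B) (x y : J → ℤ) :
    x ⬝ᵥ B *ᵥ y = y ⬝ᵥ B *ᵥ x := by
  have hT : Bᵀ = B := by ext i j; exact hB.symm j i
  rw [dotProduct_mulVec, dotProduct_comm, ← mulVec_transpose, hT]

lemma mulVec_single_self (hA : IsSimplyLacedCartan A) (i : I) :
    (A *ᵥ Pi.single i 1) i = 2 := by
  simp [hA.diag]

lemma simpleRefl_single (hA : IsSimplyLacedCartan A) (i : I) :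
    simpleRefl A i (Pi.single i 1) = -Pi.single i 1 := by
  rw [simpleRefl_apply, hA.mulVec_single_self, two_smul]; abel

lemma simpleRefl_mul_self (hA : IsSimplyLacedCartan A) (i : I) :
    simpleRefl A i * simpleRefl A i = 1 := by
  refine LinearMap.ext fun x => ?_
  rw [Module.End.mul_apply, simpleRefl_apply (x := x), map_sub, map_smul, hA.simpleRefl_single,
    simpleRefl_apply]
  simp

lemma pairing_simpleRefl (hA : IsSimplyLacedCartan A) (i : I) (x y : I → ℤ) :
    simpleRefl A i x ⬝ᵥ A *ᵥ simpleRefl A i y = x ⬝ᵥ A *ᵥ y := by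
  have h : x ⬝ᵥ A *ᵥ Pi.single i 1 = (A *ᵥ x) i := by
    rw [hA.pairing_comm]; simp
  simp only [simpleRefl_apply, mulVec_sub, mulVec_smul, sub_dotProduct, dotProduct_sub,
    smul_dotProduct, dotProduct_smul, h, single_one_dotProduct, hA.mulVec_single_self, smul_eq_mul]
  ring

lemma pairing_wordProd (hA : IsSimplyLacedCartan A) (l : List I) (x y : I → ℤ) :
    wordProd A l x ⬝ᵥ A *ᵥ wordProd A l y = x ⬝ᵥ A *ᵥ y := by
  induction l with
  | nil => rfl
  | cons i l ih => rw [wordProd_cons, Module.End.mul_apply, Module.End.mul_apply,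
      hA.pairing_simpleRefl, ih]

lemma pairing_pos {J : Type*} [Fintype J] {B : Matrix J J ℤ}
    (hB : IsSimplyLacedCartan B) {x : J → ℤ} (hx : x ≠ 0) :
    0 < x ⬝ᵥ B *ᵥ x := by
  simpa [dotProduct, mulVec, Finset.mul_sum, mul_assoc] using hB.posDef x hx

lemma even_pairing_self (hA : IsSimplyLacedCartan A) (x : I → ℤ) : Even (x ⬝ᵥ A *ᵥ x) := by
  rw [← Finset.univ_sum_single x]
  induction (Finset.univ : Finset I) using Finset.induction_on with
  | empty => simp
  | insert i s hi ih =>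
    rw [Finset.sum_insert hi, mulVec_add, add_dotProduct, dotProduct_add, dotProduct_add,
      hA.pairing_comm (∑ j ∈ s, Pi.single j (x j)) (Pi.single i (x i))]
    have h : Even (Pi.single i (x i) ⬝ᵥ A *ᵥ Pi.single i (x i)) := by
      simp [hA.diag]
    grind

lemma two_le_pairing_self (hA : IsSimplyLacedCartan A) {x : I → ℤ} (hx : x ≠ 0) :
    2 ≤ x ⬝ᵥ A *ᵥ x := by
  have h1 := hA.pairing_pos hx
  obtain ⟨c, hc⟩ := hA.even_pairing_self x
  omega

lemma pairing_posPart_negPart_nonpos {J : Type*} [Fintype J] {B : Matrix J J ℤ}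
    (hB : IsSimplyLacedCartan B) (x : J → ℤ) :
    x⁺ ⬝ᵥ B *ᵥ x⁻ ≤ 0 := by
  refine Finset.sum_nonpos fun i _ => ?_
  rw [mulVec, dotProduct, Finset.mul_sum]
  refine Finset.sum_nonpos fun j _ => ?_
  have hi : 0 ≤ x⁺ i := posPart_nonneg x i
  have hj : 0 ≤ x⁻ j := negPart_nonneg x j
  rcases eq_or_ne i j with rfl | hij
  · have : x⁺ i * x⁻ i = 0 := by
      rw [Pi.posPart_apply, Pi.negPart_apply]
      rcases le_total 0 (x i) with h | h
      · simp [negPart_eq_zero.2 h]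
      · simp [posPart_eq_zero.2 h]
    rw [mul_left_comm, this, mul_zero]
  · have hle : B i j ≤ 0 := by rcases hB.offDiag i j hij with h | h <;> simp [h]
    exact mul_nonpos_of_nonneg_of_nonpos hi (mul_nonpos_of_nonpos_of_nonneg hle hj)

/-- A vector of norm `2` has all its coefficients of the same sign. -/
lemma nonneg_or_nonpos (hA : IsSimplyLacedCartan A) {x : I → ℤ} (hx : x ⬝ᵥ A *ᵥ x = 2) :
    0 ≤ x ∨ x ≤ 0 := by
  by_contra! hcon
  have hp : x⁺ ≠ 0 := fun h => hcon.2 (posPart_eq_zero.1 h)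
  have hn : x⁻ ≠ 0 := fun h => hcon.1 (negPart_eq_zero.1 h)
  have h1 := hA.two_le_pairing_self hp
  have h2 := hA.two_le_pairing_self hn
  have h3 := hA.pairing_posPart_negPart_nonpos x
  rw [← posPart_sub_negPart x, mulVec_sub, sub_dotProduct, dotProduct_sub, dotProduct_sub,
    hA.pairing_comm x⁻ x⁺] at hx
  omega

/-- A multiple of a simple root has norm `2` only if the factor is `1` or `-1`. -/
lemma sq_eq_one_of_pairing_smul_single (hA : IsSimplyLacedCartan A) {i : I} {c : ℤ}
    (h : (c • Pi.single i 1 : I → ℤ) ⬝ᵥ A *ᵥ (c • Pi.single i 1) = 2) : c ^ 2 = 1 := by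
  rw [mulVec_smul, smul_dotProduct, dotProduct_smul, single_one_dotProduct,
    hA.mulVec_single_self] at h
  simp only [smul_eq_mul] at h
  nlinarith

lemma eq_single_of_simpleRefl_nonpos (hA : IsSimplyLacedCartan A) {k : I} {x : I → ℤ}
    (hx : x ⬝ᵥ A *ᵥ x = 2) (h0 : 0 ≤ x) (hk : simpleRefl A k x ≤ 0) :
    x = Pi.single k 1 := by
  have hxk : x = x k • Pi.single k 1 := by
    ext j
    rcases eq_or_ne j k with rfl | hj
    · simp
    · have h1 := hk j
      have h2 := h0 j
      simp only [simpleRefl_apply, Pi.sub_apply, Pi.smul_apply, Pi.zero_apply,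
        Pi.single_eq_of_ne hj, smul_zero, sub_zero] at h1 h2 ⊢
      omega
  have hsq : x k ^ 2 = 1 := hA.sq_eq_one_of_pairing_smul_single (i := k) (by rwa [← hxk])
  have h1 : x k = 1 := by
    have := h0 k
    simp only [Pi.zero_apply] at this
    nlinarith
  rw [hxk, h1, one_smul]

lemma pairing_wordProd_single (hA : IsSimplyLacedCartan A) (l : List I) (i : I) :
    wordProd A l (Pi.single i 1) ⬝ᵥ A *ᵥ wordProd A l (Pi.single i 1) = 2 := by
  rw [hA.pairing_wordProd, single_one_dotProduct, hA.mulVec_single_self]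

lemma wordProd_mul_simpleRefl (hA : IsSimplyLacedCartan A) {l : List I} {i k : I}
    (h : wordProd A l (Pi.single i 1) = Pi.single k 1) :
    wordProd A l * simpleRefl A i = simpleRefl A k * wordProd A l := by
  refine LinearMap.ext fun x => ?_
  have hx : (A *ᵥ wordProd A l x) k = (A *ᵥ x) i := by
    rw [← single_one_dotProduct k (A *ᵥ wordProd A l x), ← h, hA.pairing_wordProd, single_one_dotProduct]
  rw [Module.End.mul_apply, Module.End.mul_apply, simpleRefl_apply, simpleRefl_apply, map_sub,
    map_smul, h, hx]

/-- The exchange property. -/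
lemma exists_length_add_one (hA : IsSimplyLacedCartan A) {l : List I} {i : I}
    (h : wordProd A l (Pi.single i 1) ≤ 0) :
    ∃ l' : List I, l'.length + 1 = l.length ∧ wordProd A l' = wordProd A l * simpleRefl A i := by
  induction l with
  | nil => simpa using h i
  | cons k l ih =>
    by_cases hl : wordProd A l (Pi.single i 1) ≤ 0
    · obtain ⟨l', hlen, hl'⟩ := ih hl
      exact ⟨k :: l', by simp [hlen], by rw [wordProd_cons, wordProd_cons, hl', mul_assoc]⟩
    · have hq := hA.pairing_wordProd_single l i
      have hk := hA.eq_single_of_simpleRefl_nonpos hq ((hA.nonneg_or_nonpos hq).resolve_right hl)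
        (by simpa using h)
      refine ⟨l, rfl, ?_⟩
      rw [wordProd_cons, mul_assoc, hA.wordProd_mul_simpleRefl hk, ← mul_assoc,
        hA.simpleRefl_mul_self, one_mul]

end IsSimplyLacedCartan

lemma len_le_of_wordProd_eq {l m : List I} (h : wordProd A m = wordProd A l) :
    len A (l.map (sE A)).prod ≤ m.length :=
  Nat.sInf_le ⟨m, rfl, coe_wordProd_eq_iff.2 h⟩

variable (A) in
lemma exists_length_eq_len (l : List I) :
    ∃ m : List I, m.length = len A (l.map (sE A)).prod ∧ wordProd A m = wordProd A l := by
  obtain ⟨m, hm, h⟩ := Nat.sInf_mem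
    (s := {n | ∃ m : List I, m.length = n ∧ (m.map (sE A)).prod = (l.map (sE A)).prod})
    ⟨_, l, rfl, rfl⟩
  exact ⟨m, hm, coe_wordProd_eq_iff.1 h⟩

namespace IsSimplyLacedCartan

/-- An element of `W` sending every simple root to a positive root is the identity. -/
lemma wordProd_eq_one (hA : IsSimplyLacedCartan A) {l : List I}
    (h : ∀ i, 0 ≤ wordProd A l (Pi.single i 1)) : wordProd A l = 1 := by
  obtain ⟨m, hm, hml⟩ := exists_length_eq_len A l
  rcases List.eq_nil_or_concat m with rfl | ⟨t, i, rfl⟩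
  · rw [← hml, wordProd_nil]
  · rw [List.concat_eq_append] at hm hml
    have hw : wordProd A l = wordProd A t * simpleRefl A i := by
      rw [← hml, wordProd_append, wordProd_cons, wordProd_nil, mul_one]
    have hneg : wordProd A t (Pi.single i 1) ≤ 0 := by
      have := h i
      rwa [hw, Module.End.mul_apply, hA.simpleRefl_single, map_neg, Left.nonneg_neg_iff] at this
    obtain ⟨t', ht', ht⟩ := hA.exists_length_add_one hneg
    have := len_le_of_wordProd_eq (ht.trans hw.symm)
    simp only [List.length_append, List.length_singleton] at hm
    omega

/-- The longest element sends every simple root to a negative root. -/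
lemma wordProd_single_nonpos (hA : IsSimplyLacedCartan A) {l : List I} {ν : ℕ}
    (hw : IsLongest A (l.map (sE A)).prod ν) (i : I) :
    wordProd A l (Pi.single i 1) ≤ 0 := by
  refine (hA.nonneg_or_nonpos (hA.pairing_wordProd_single l i)).resolve_left fun h => ?_
  obtain ⟨m, hm, hml⟩ := exists_length_eq_len A (l ++ [i])
  rw [wordProd_append, wordProd_cons, wordProd_nil, mul_one] at hml
  have hneg : wordProd A m (Pi.single i 1) ≤ 0 := by
    rw [hml, Module.End.mul_apply, hA.simpleRefl_single, map_neg]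
    exact neg_nonpos.2 h
  obtain ⟨m', hm', hmm⟩ := hA.exists_length_add_one hneg
  rw [hml, mul_assoc, hA.simpleRefl_mul_self, mul_one] at hmm
  have h1 := len_le_of_wordProd_eq hmm
  have h2 := hw.longest _ ⟨l ++ [i], rfl⟩
  have h3 := hw.len_eq
  omega

lemma wordProd_mul_self (hA : IsSimplyLacedCartan A) {l : List I} {ν : ℕ}
    (hw : IsLongest A (l.map (sE A)).prod ν) : wordProd A l * wordProd A l = 1 := by
  rw [← wordProd_append]
  refine hA.wordProd_eq_one fun i => ?_
  have hx := hA.wordProd_single_nonpos hw i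
  rw [wordProd_append, Module.End.mul_apply]
  generalize wordProd A l (Pi.single i 1) = x at hx
  rw [pi_eq_sum_univ' x, map_sum]
  refine Finset.sum_nonneg fun j _ => ?_
  rw [map_smul]
  have hj := hA.wordProd_single_nonpos hw j
  intro k
  have h1 := hj k
  have h2 := hx j
  simp only [Pi.zero_apply, Pi.smul_apply, smul_eq_mul] at h1 h2 ⊢
  exact mul_nonneg_of_nonpos_of_nonpos h2 h1

/-- If `s_j = w₀ s_i w₀` then `w₀` exchanges the simple coroots `i` and `j` up to sign. -/
lemma mulVec_longest (hA : IsSimplyLacedCartan A) {l : List I} {ν : ℕ}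
    (hw : IsLongest A (l.map (sE A)).prod ν) {i j : I}
    (hij : simpleRefl A j = wordProd A l * simpleRefl A i * wordProd A l) (x : I → ℤ) :
    (A *ᵥ wordProd A l x) j = -(A *ᵥ x) i := by
  set w := wordProd A l with hw'
  have hinv := hA.wordProd_mul_self hw
  have key (y : I → ℤ) :
      (A *ᵥ w y) j • (Pi.single j 1 : I → ℤ) = (A *ᵥ y) i • w (Pi.single i 1) := by
    have h1 : simpleRefl A j * w = w * simpleRefl A i := by
      rw [hij, mul_assoc, hinv, mul_one]
    have h2 := LinearMap.congr_fun h1 y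
    rw [Module.End.mul_apply, Module.End.mul_apply, simpleRefl_apply, simpleRefl_apply, map_sub,
      map_smul] at h2
    exact sub_right_injective h2
  obtain ⟨c, hc⟩ : ∃ c : ℤ, w (Pi.single i 1) = c • Pi.single j 1 := by
    refine ⟨w (Pi.single i 1) j, funext fun k => ?_⟩
    rcases eq_or_ne k j with rfl | hk
    · simp
    · have := congrFun (key (Pi.single i 1)) k
      rw [hA.mulVec_single_self] at this
      simpa [hk] using this
  have hsq : c ^ 2 = 1 := hA.sq_eq_one_of_pairing_smul_single (i := j)
    (by rw [← hc]; exact hA.pairing_wordProd_single l i)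
  have hc0 : c ≤ 0 := by
    have := hA.wordProd_single_nonpos hw i j
    rw [← hw', hc] at this
    simpa using this
  have hc1 : c = -1 := by nlinarith
  have := congrFun (key x) j
  rw [hc, hc1] at this
  simpa using this

end IsSimplyLacedCartan

/-- `Σ_k r_{h,k} p_{i_k} = Σ_i (p_i + p_{i^!}) b_{ih}` where
`(b_{ij})` is the inverse of the Cartan matrix and `s_{i^!} = w₀ s_i w₀`. -/
theorem norm_h_p_formula (A : Matrix I I ℤ) (hA : IsSimplyLacedCartan A)
    (w₀ : Function.End (I → ℤ)) (ν : ℕ) (hw : IsLongest A w₀ ν)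
    (pv : I → ℕ) (h : I) (f : Fin ν → I) (hf : f ∈ RedWord A w₀ ν)
    (b : Matrix I I ℚ)
    (hb : A.map (fun z => (z : ℚ)) * b = 1)
    (hb' : b * A.map (fun z => (z : ℚ)) = 1)
    (excl : I → I) (hexcl : ∀ i : I, sE A (excl i) = w₀ * sE A i * w₀) :
    (∑ k : Fin ν, (rCoef A f h k : ℚ) * (pv (f k) : ℚ))
      = ∑ i : I, ((pv i : ℚ) + (pv (excl i) : ℚ)) * b i h := by
  obtain rfl : ((List.ofFn f).map (sE A)).prod = w₀ := hf
  have hconj (i : I) : simpleRefl A (excl i) =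
      wordProd A (List.ofFn f) * simpleRefl A i * wordProd A (List.ofFn f) := by
    have := hexcl i
    rw [coe_wordProd] at this
    exact DFunLike.coe_injective this
  have hmap : A.map (fun z => (z : ℚ)) = (Int.castRingHom ℚ).mapMatrix A := rfl
  have hdet : (A.det : ℚ) ≠ 0 := by
    have h1 : (A.map fun z => (z : ℚ)).det * b.det = 1 := by rw [← det_mul, hb, det_one]
    rw [hmap, ← RingHom.map_det] at h1
    exact left_ne_zero_of_mul_eq_one h1
  set x : I → ℤ := A.adjugate *ᵥ fun i => (pv i : ℤ) with hx
  have hAx (i : I) : (A *ᵥ x) i = A.det * pv i := by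
    rw [hx, mulVec_mulVec, mul_adjugate, smul_mulVec, one_mulVec]; rfl
  have hsum := sum_rCoef_mul_mulVec (A := A) f h x
  clear_value x
  generalize A.det = D at hdet hAx
  set y : I → ℤ := x - wordProd A (List.ofFn f) x with hy
  have hAy (i : I) : (A *ᵥ y) i = D * (pv i + pv (excl i)) := by
    have h1 := hA.mulVec_longest hw (hconj i) (wordProd A (List.ofFn f) x)
    rw [← Module.End.mul_apply, hA.wordProd_mul_self hw, Module.End.one_apply] at h1
    rw [hy, mulVec_sub, Pi.sub_apply, hAx, mul_add, ← hAx (excl i), h1, sub_eq_add_neg]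
  have hyh : (y h : ℚ) = ∑ i, (D * (pv i + pv (excl i)) : ℚ) * b i h := by
    have h1 (i : I) : (D * (pv i + pv (excl i)) : ℚ) = ∑ j, (y j : ℚ) * (A j i : ℤ) := by
      have := congrArg (Int.cast : ℤ → ℚ) (hAy i)
      push_cast at this
      rw [← this, mulVec, dotProduct]
      push_cast
      exact Finset.sum_congr rfl fun j _ => by rw [hA.symm i j, mul_comm]
    have h2 : (fun j => (y j : ℚ)) ᵥ* (A.map (fun z => (z : ℚ)) * b) = fun j => (y j : ℚ) := by
      rw [hb, vecMul_one]
    rw [← vecMul_vecMul] at h2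
    rw [← congrFun h2 h]
    exact Finset.sum_congr rfl fun i _ => by rw [h1 i]; rfl
  refine mul_left_cancel₀ hdet ?_
  have hsum' := congrArg (Int.cast : ℤ → ℚ) hsum
  rw [hyh] at hsum'
  simp only [hAx] at hsum'
  push_cast at hsum'
  rw [Finset.mul_sum, Finset.mul_sum]
  convert hsum' using 2 <;> ring

end Lusztig
end

section
/- Let K = ℤ be the tropical semifield, let n ∈ ℕ, and let A be an equivalence class for ∼ contained in ℐ×ℕ^ν such that a_1 ≤ n for every (i,a) ∈ A. Then for every (i,a) ∈ A and every k ∈ {1,…,ν} one has a_k ≤ 2^{k-1}·n. -/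
open scoped BigOperators

namespace Lusztig

variable {I : Type*} [Fintype I] [DecidableEq I]

set_option linter.unusedSectionVars false

/-- The bilinear form on `ℤ[I]` attached to `A`. -/
def form (A : Matrix I I ℤ) (x y : I → ℤ) : ℤ := x ⬝ᵥ A.mulVec y

/-- The simple reflection `s_i` as a linear endomorphism. -/
def reflection (A : Matrix I I ℤ) (i : I) : Module.End ℤ (I → ℤ) :=
  LinearMap.id - ((LinearMap.proj i).comp A.mulVecLin).smulRight (Pi.single i 1)

/-- The linear endomorphism `s_{i_1} ⋯ s_{i_k}` attached to a word. -/
def act (A : Matrix I I ℤ) (l : List I) : Module.End ℤ (I → ℤ) :=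
  (l.map (reflection A)).prod

/-- A word is reduced if no shorter word represents the same element. -/
def IsReducedWord (A : Matrix I I ℤ) (l : List I) : Prop :=
  ∀ l', act A l' = act A l → l.length ≤ l'.length

lemma reflection_apply (A : Matrix I I ℤ) (i : I) (v : I → ℤ) :
    reflection A i v = v - (A.mulVec v i) • Pi.single i 1 := by
  simp [reflection]

lemma sE_eq_reflection (A : Matrix I I ℤ) (i : I) (v : I → ℤ) :
    sE A i v = reflection A i v := by
  rw [reflection_apply]; rfl

lemma prod_sE_apply (A : Matrix I I ℤ) (l : List I) (v : I → ℤ) :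
    (l.map (sE A)).prod v = act A l v := by
  induction l with
  | nil => rfl
  | cons i l ih =>
    change sE A i ((l.map (sE A)).prod v) = _
    rw [ih, sE_eq_reflection]
    simp [act]

lemma prod_sE_eq_iff (A : Matrix I I ℤ) (l l' : List I) :
    (l.map (sE A)).prod = (l'.map (sE A)).prod ↔ act A l = act A l' := by
  constructor
  · intro h
    ext1 v
    ext1
    simp only [LinearMap.comp_apply, ← prod_sE_apply, h]
  · intro h
    funext v
    rw [prod_sE_apply, prod_sE_apply, h]

@[simp] lemma act_nil (A : Matrix I I ℤ) : act A [] = 1 := rfl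

@[simp] lemma act_cons (A : Matrix I I ℤ) (i : I) (l : List I) :
    act A (i :: l) = reflection A i * act A l := by simp [act]

@[simp] lemma act_append (A : Matrix I I ℤ) (l l' : List I) :
    act A (l ++ l') = act A l * act A l' := by simp [act]

namespace IsSimplyLacedCartan

variable {A : Matrix I I ℤ}

lemma form_comm (hA : IsSimplyLacedCartan A) (x y : I → ℤ) : form A x y = form A y x := by
  have hT : A.transpose = A := by
    ext i j
    exact hA.symm j i
  unfold form
  rw [Matrix.dotProduct_mulVec, ← Matrix.mulVec_transpose, hT, dotProduct_comm]

lemma form_single_self (hA : IsSimplyLacedCartan A) (i : I) :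
    form A (Pi.single i 1) (Pi.single i 1) = 2 := by
  simp [form, hA.diag]

lemma form_reflection (hA : IsSimplyLacedCartan A) (i : I) (x y : I → ℤ) :
    form A (reflection A i x) (reflection A i y) = form A x y := by
  have h1 : ∀ v, form A (Pi.single i 1) v = A.mulVec v i := fun v ↦ by simp [form]
  have h2 : ∀ v, form A v (Pi.single i 1) = A.mulVec v i := fun v ↦ by rw [hA.form_comm, h1]
  have h3 := (h1 _).symm.trans (hA.form_single_self i)
  unfold form at h1 h2 ⊢
  simp only [reflection_apply, Matrix.mulVec_sub, Matrix.mulVec_smul, sub_dotProduct,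
    dotProduct_sub, smul_dotProduct, dotProduct_smul, h1, h2, h3, smul_eq_mul,
    Pi.sub_apply, Pi.smul_apply]
  ring

lemma form_act (hA : IsSimplyLacedCartan A) (l : List I) (x y : I → ℤ) :
    form A (act A l x) (act A l y) = form A x y := by
  induction l with
  | nil => rfl
  | cons i l ih => simpa [hA.form_reflection] using ih

lemma reflection_mul_self (hA : IsSimplyLacedCartan A) (i : I) :
    reflection A i * reflection A i = 1 := by
  apply LinearMap.ext
  intro v
  simp only [Module.End.mul_apply, Module.End.one_apply, reflection_apply, Matrix.mulVec_sub,
    Matrix.mulVec_smul, Pi.sub_apply, Pi.smul_apply, Matrix.mulVec_single_one, Matrix.col_apply,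
    hA.diag]
  module

lemma reflection_single (hA : IsSimplyLacedCartan A) (i : I) :
    reflection A i (Pi.single i 1) = -Pi.single i 1 := by
  simp only [reflection_apply, Matrix.mulVec_single_one, Matrix.col_apply, hA.diag]
  module

lemma reflection_single_of_ne (i j : I) :
    reflection A i (Pi.single j 1) = Pi.single j 1 - A i j • Pi.single i 1 := by
  simp [reflection_apply]

lemma reflection_comm (hA : IsSimplyLacedCartan A) {i j : I} (hij : A i j = 0) :
    reflection A i * reflection A j = reflection A j * reflection A i := by
  have hji : A j i = 0 := hA.symm i j ▸ hij
  apply LinearMap.ext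
  intro v
  simp only [Module.End.mul_apply, reflection_apply, Matrix.mulVec_sub,
    Matrix.mulVec_smul, Pi.sub_apply, Pi.smul_apply, Matrix.mulVec_single_one, Matrix.col_apply,
    hij, hji]
  module

lemma reflection_braid (hA : IsSimplyLacedCartan A) {i j : I} (hij : A i j = -1) :
    reflection A i * (reflection A j * reflection A i) =
      reflection A j * (reflection A i * reflection A j) := by
  have hji : A j i = -1 := hA.symm i j ▸ hij
  apply LinearMap.ext
  intro v
  simp only [Module.End.mul_apply, reflection_apply, Matrix.mulVec_sub,
    Matrix.mulVec_smul, Pi.sub_apply, Pi.smul_apply, Matrix.mulVec_single_one, Matrix.col_apply,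
    hij, hji, hA.diag, smul_eq_mul]
  module

lemma act_mul_act_reverse (hA : IsSimplyLacedCartan A) (l : List I) :
    act A l * act A l.reverse = 1 := by
  induction l with
  | nil => rfl
  | cons i l ih =>
    calc act A (i :: l) * act A (i :: l).reverse
        = reflection A i * (act A l * act A l.reverse) * reflection A i := by simp [mul_assoc]
      _ = 1 := by rw [ih, mul_one, hA.reflection_mul_self]

lemma even_form_self (hA : IsSimplyLacedCartan A) (x : I → ℤ) : Even (form A x x) := by
  have key : ∀ s : Finset I, Even (form A (∑ i ∈ s, x i • Pi.single i 1)
      (∑ i ∈ s, x i • Pi.single i 1)) := by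
    intro s
    induction s using Finset.induction_on with
    | empty => simp [form]
    | insert i s hi ih =>
      rw [Finset.sum_insert hi]
      set y : I → ℤ := ∑ i ∈ s, x i • Pi.single i 1
      have hc := hA.form_comm y (Pi.single i 1)
      have h2 := hA.form_single_self i
      have : form A (x i • Pi.single i 1 + y) (x i • Pi.single i 1 + y) =
          form A y y + 2 * (x i * form A (Pi.single i 1) y + x i * x i) := by
        unfold form at hc h2 ⊢
        simp only [Matrix.mulVec_add, Matrix.mulVec_smul, add_dotProduct, dotProduct_add,
          smul_dotProduct, dotProduct_smul, smul_eq_mul, hc, h2]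
        ring
      rw [this]
      exact ih.add (even_two_mul _)
  have hx : x = ∑ i, x i • Pi.single i 1 := by
    ext k
    simp [Finset.sum_apply, Pi.single_apply]
  rw [hx]
  exact key _

lemma two_le_form_self (hA : IsSimplyLacedCartan A) {x : I → ℤ} (hx : x ≠ 0) :
    2 ≤ form A x x := by
  have h := hA.posDef x hx
  have h' : form A x x = ∑ i, ∑ j, x i * A i j * x j := by
    simp [form, dotProduct, Matrix.mulVec, Finset.mul_sum, mul_assoc]
  obtain ⟨m, hm⟩ := hA.even_form_self x
  omega

lemma nonneg_or_nonpos_of_form_eq_two (hA : IsSimplyLacedCartan A) {x : I → ℤ}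
    (hx : form A x x = 2) : 0 ≤ x ∨ x ≤ 0 := by
  set p : I → ℤ := fun i ↦ max (x i) 0
  set m : I → ℤ := fun i ↦ max (-x i) 0
  have hxpm : x = p - m := by
    ext i
    simp only [p, m, Pi.sub_apply]
    omega
  have hpm : form A p m ≤ 0 := by
    simp only [form, dotProduct, Matrix.mulVec, Finset.mul_sum]
    refine Finset.sum_nonpos fun i _ ↦ Finset.sum_nonpos fun j _ ↦ ?_
    by_cases hij : i = j
    · subst hij
      rcases le_total (x i) 0 with h | h
      · simp [p, h]
      · simp [m, h]
    · have hp : 0 ≤ p i := le_max_right _ _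
      have hm : 0 ≤ m j := le_max_right _ _
      rcases hA.offDiag i j hij with h | h
      · simp [h]
      · rw [h]
        nlinarith [mul_nonneg hp hm]
  have hexp : form A x x = form A p p + form A m m - 2 * form A p m := by
    have hc := hA.form_comm m p
    rw [hxpm]
    unfold form at hc ⊢
    simp only [Matrix.mulVec_sub, sub_dotProduct, dotProduct_sub, hc]
    ring
  by_cases hp : p = 0
  · right
    intro i
    have := congrFun hp i
    simpa [p] using this
  by_cases hm : m = 0
  · left
    intro i
    have := congrFun hm i
    simpa [m] using this
  have := hA.two_le_form_self hp
  have := hA.two_le_form_self hm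
  omega

lemma form_act_single (hA : IsSimplyLacedCartan A) (l : List I) (j : I) :
    form A (act A l (Pi.single j 1)) (act A l (Pi.single j 1)) = 2 := by
  rw [hA.form_act, hA.form_single_self]

lemma eq_single_of_not_nonneg_reflection (hA : IsSimplyLacedCartan A) {i : I} {x : I → ℤ}
    (hx : form A x x = 2) (h0 : 0 ≤ x) (hs : ¬ 0 ≤ reflection A i x) : x = Pi.single i 1 := by
  have hs' := (hA.nonneg_or_nonpos_of_form_eq_two
    ((hA.form_reflection i x x).trans hx)).resolve_left hs
  have hk : ∀ k, k ≠ i → x k = 0 := by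
    intro k hk
    have h1 := hs' k
    have h2 := h0 k
    simp only [reflection_apply, Pi.sub_apply, Pi.smul_apply, Pi.zero_apply, Pi.single_apply,
      if_neg hk, smul_zero, sub_zero] at h1 h2
    omega
  have hxi : x = x i • Pi.single i 1 := by
    ext k
    by_cases hki : k = i
    · subst hki; simp
    · simp [hk k hki, hki]
  have hsq : x i * x i = 1 := by
    have h2 := hA.form_single_self i
    rw [hxi] at hx
    unfold form at hx h2
    simp only [Matrix.mulVec_smul, smul_dotProduct, dotProduct_smul, h2, smul_eq_mul] at hx
    linarith
  have hi : 0 ≤ x i := h0 i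
  have h1 : x i = 1 := by nlinarith
  rw [hxi, h1, one_smul]

lemma exchange (hA : IsSimplyLacedCartan A) (l : List I) (j : I)
    (h : ¬ 0 ≤ act A l (Pi.single j 1)) :
    ∃ l', l'.length + 1 = l.length ∧ act A l' = act A l * reflection A j := by
  induction l with
  | nil => exact absurd (Pi.single_nonneg.2 zero_le_one) h
  | cons i t ih =>
    by_cases ht : 0 ≤ act A t (Pi.single j 1)
    · have hi := hA.eq_single_of_not_nonneg_reflection (hA.form_act_single t j) ht
        (by simpa using h)
      have hconj : reflection A i * act A t = act A t * reflection A j := by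
        apply LinearMap.ext
        intro v
        have hf := hA.form_act t (Pi.single j 1) v
        rw [hi] at hf
        simp only [form, single_one_dotProduct] at hf
        simp only [Module.End.mul_apply, reflection_apply, map_sub, map_smul, hi, hf]
      refine ⟨t, rfl, ?_⟩
      rw [act_cons, hconj, mul_assoc, hA.reflection_mul_self, mul_one]
    · obtain ⟨l', hl, hl'⟩ := ih ht
      exact ⟨i :: l', by simpa using hl, by simp [hl', mul_assoc]⟩

end IsSimplyLacedCartan

namespace IsReducedWord

variable {A : Matrix I I ℤ}

lemma of_append_left {l m : List I} (h : IsReducedWord A (l ++ m)) : IsReducedWord A l := by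
  intro l' hl'
  have := h (l' ++ m) (by simp [hl'])
  simpa using this

lemma of_append_right {l m : List I} (h : IsReducedWord A (l ++ m)) : IsReducedWord A m := by
  intro m' hm'
  have := h (l ++ m') (by simp [hm'])
  simpa using this

lemma of_act_eq {l m : List I} (h : IsReducedWord A l) (hact : act A m = act A l)
    (hlen : m.length = l.length) : IsReducedWord A m :=
  fun l' hl' ↦ hlen ▸ h l' (hl'.trans hact)

lemma reverse (hA : IsSimplyLacedCartan A) {l : List I} (h : IsReducedWord A l) :
    IsReducedWord A l.reverse := by
  intro l' hl'
  have h1 := hA.act_mul_act_reverse l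
  have h2 := hA.act_mul_act_reverse l'
  have : act A l'.reverse = act A l := by
    rw [hl'] at h2
    calc act A l'.reverse = act A l * act A l.reverse * act A l'.reverse := by rw [h1, one_mul]
      _ = act A l := by rw [mul_assoc, h2, mul_one]
  simpa using h _ this

lemma act_single_nonneg (hA : IsSimplyLacedCartan A) {l : List I} {i : I}
    (h : IsReducedWord A (l ++ [i])) : 0 ≤ act A l (Pi.single i 1) := by
  by_contra hn
  obtain ⟨l', hl, hl'⟩ := hA.exchange l i hn
  have := h l' (by simpa using hl')
  simp at this
  omega

end IsReducedWord

/-- A braid move on labelled words, together with its effect on the labels. -/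
inductive BraidMove (A : Matrix I I ℤ) : List (I × ℤ) → List (I × ℤ) → Prop
  | braid (P S : List (I × ℤ)) (i j : I) (a b c : ℤ) (h : A i j = -1) :
    BraidMove A (P ++ [(i, a), (j, b), (i, c)] ++ S)
      (P ++ [(j, b + c - min a c), (i, min a c), (j, a + b - min a c)] ++ S)
  | comm (P S : List (I × ℤ)) (i j : I) (a b : ℤ) (h : A i j = 0) :
    BraidMove A (P ++ [(i, a), (j, b)] ++ S) (P ++ [(j, b), (i, a)] ++ S)

namespace BraidMove

variable {A : Matrix I I ℤ} {x y : List (I × ℤ)}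

lemma append (h : BraidMove A x y) (p q : List (I × ℤ)) :
    BraidMove A (p ++ x ++ q) (p ++ y ++ q) := by
  cases h with
  | braid P S i j a b c h => simpa using braid (p ++ P) (S ++ q) i j a b c h
  | comm P S i j a b h => simpa using comm (p ++ P) (S ++ q) i j a b h

lemma reverse (hA : IsSimplyLacedCartan A) (h : BraidMove A x y) :
    BraidMove A x.reverse y.reverse := by
  cases h with
  | braid P S i j a b c h =>
    have := braid S.reverse P.reverse i j c b a h
    simpa [min_comm, add_comm] using this
  | comm P S i j a b h =>
    simpa using comm S.reverse P.reverse j i b a (hA.symm i j ▸ h)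

lemma length_eq (h : BraidMove A x y) : y.length = x.length := by
  cases h <;> simp

lemma act_eq (hA : IsSimplyLacedCartan A) (h : BraidMove A x y) :
    act A (y.map Prod.fst) = act A (x.map Prod.fst) := by
  cases h with
  | braid P S i j a b c h =>
    have h' := hA.reflection_braid h
    simp only [List.map_append, List.map_cons, List.map_nil, act_append, act_cons, act_nil,
      mul_one, h']
  | comm P S i j a b h =>
    have h' := hA.reflection_comm h
    simp only [List.map_append, List.map_cons, List.map_nil, act_append, act_cons, act_nil,
      mul_one, h']

end BraidMove

open Relation in
lemma IsReducedWord.of_reflTransGen {A : Matrix I I ℤ} (hA : IsSimplyLacedCartan A)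
    {x y : List (I × ℤ)} (hx : IsReducedWord A (x.map Prod.fst))
    (h : ReflTransGen (BraidMove A) x y) :
    IsReducedWord A (y.map Prod.fst) ∧ y.length = x.length ∧
      act A (y.map Prod.fst) = act A (x.map Prod.fst) := by
  induction h with
  | refl => exact ⟨hx, rfl, rfl⟩
  | tail _ h ih =>
    refine ⟨ih.1.of_act_eq (h.act_eq hA) (by simpa using h.length_eq), ?_, ?_⟩
    · rw [h.length_eq, ih.2.1]
    · rw [h.act_eq hA, ih.2.2]

open Relation in
lemma reflTransGen_braidMove_append {A : Matrix I I ℤ} {x y : List (I × ℤ)}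
    (h : ReflTransGen (BraidMove A) x y) (p q : List (I × ℤ)) :
    ReflTransGen (BraidMove A) (p ++ x ++ q) (p ++ y ++ q) :=
  h.lift (fun z ↦ p ++ z ++ q) fun _ _ hm ↦ hm.append p q

open Relation in
/-- A labelled reduced word whose element has `j` as a right descent can be moved
to one that ends in `j`. -/
lemma exists_reflTransGen_concat {A : Matrix I I ℤ} (hA : IsSimplyLacedCartan A)
    (x : List (I × ℤ)) (hx : IsReducedWord A (x.map Prod.fst)) (j : I)
    (hj : ¬ 0 ≤ act A (x.map Prod.fst) (Pi.single j 1)) :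
    ∃ y c, ReflTransGen (BraidMove A) x (y ++ [(j, c)]) := by
  induction hn : x.length using Nat.strong_induction_on generalizing x j with
  | _ n ih =>
    rcases List.eq_nil_or_concat' x with rfl | ⟨z, ⟨i, a⟩, rfl⟩
    · exact absurd (Pi.single_nonneg.2 zero_le_one) hj
    by_cases hij : i = j
    · subst hij
      exact ⟨z, a, .refl⟩
    have hz : IsReducedWord A (z.map Prod.fst) := by
      rw [List.map_append] at hx
      exact hx.of_append_left
    have hzlen : z.length < n := by simp [← hn]
    rcases hA.offDiag i j hij with h0 | h1
    · have hzj : ¬ 0 ≤ act A (z.map Prod.fst) (Pi.single j 1) := by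
        simpa [IsSimplyLacedCartan.reflection_single_of_ne, h0] using hj
      obtain ⟨y, c, hy⟩ := ih _ hzlen z hz j hzj rfl
      have h := reflTransGen_braidMove_append hy [] [(i, a)]
      have hm := BraidMove.comm y [] j i c a (hA.symm i j ▸ h0)
      simp only [List.append_assoc, List.nil_append, List.cons_append, List.append_nil] at h hm
      exact ⟨y ++ [(i, a)], c, by simpa using h.tail hm⟩
    · have hi : 0 ≤ act A (z.map Prod.fst) (Pi.single i 1) :=
        IsReducedWord.act_single_nonneg hA (by simpa using hx)
      have hj' : ¬ 0 ≤ act A (z.map Prod.fst) (Pi.single j 1) +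
          act A (z.map Prod.fst) (Pi.single i 1) := by
        simpa [IsSimplyLacedCartan.reflection_single_of_ne, h1] using hj
      have hzj : ¬ 0 ≤ act A (z.map Prod.fst) (Pi.single j 1) := fun h ↦ hj' (add_nonneg h hi)
      obtain ⟨y, c, hy⟩ := ih _ hzlen z hz j hzj rfl
      obtain ⟨hyr, hylen, hyact⟩ := hz.of_reflTransGen hA hy
      have hyi : ¬ 0 ≤ act A (y.map Prod.fst) (Pi.single i 1) := by
        rw [← map_add, ← hyact] at hj'
        simpa [IsSimplyLacedCartan.reflection_single_of_ne, hA.reflection_single,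
          hA.symm j i, h1] using hj'
      have hyr' : IsReducedWord A (y.map Prod.fst) := by
        rw [List.map_append] at hyr
        exact hyr.of_append_left
      have hylen' : y.length < n := by
        simp at hylen
        omega
      obtain ⟨t, b, ht⟩ := ih _ hylen' y hyr' i hyi rfl
      have h := reflTransGen_braidMove_append hy [] [(i, a)]
      have h' := reflTransGen_braidMove_append ht [] [(j, c), (i, a)]
      have hm := BraidMove.braid t [] i j b c a h1
      simp only [List.append_assoc, List.nil_append, List.cons_append, List.append_nil] at h h' hm
      exact ⟨t ++ [(j, c + a - min b a), (i, min b a)], b + c - min b a, by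
        simpa using (h.trans h').tail hm⟩

open Relation in
lemma exists_reflTransGen_cons {A : Matrix I I ℤ} (hA : IsSimplyLacedCartan A)
    (x : List (I × ℤ)) (hx : IsReducedWord A (x.map Prod.fst)) (j : I)
    (hj : ¬ 0 ≤ act A (x.map Prod.fst).reverse (Pi.single j 1)) :
    ∃ y c, ReflTransGen (BraidMove A) x ((j, c) :: y) := by
  obtain ⟨y, c, h⟩ := exists_reflTransGen_concat hA x.reverse
    (by simpa using hx.reverse hA) j (by simpa using hj)
  have h' : ReflTransGen (BraidMove A) x.reverse.reverse (y ++ [(j, c)]).reverse :=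
    h.lift List.reverse fun _ _ hm ↦ hm.reverse hA
  exact ⟨y.reverse, c, by simpa using h'⟩

/-- The longest element sends every simple root to a nonpositive vector. -/
lemma act_single_nonpos_of_longest {A : Matrix I I ℤ} (hA : IsSimplyLacedCartan A)
    {w : List I} (hw : IsReducedWord A w)
    (hmax : ∀ l, IsReducedWord A l → l.length ≤ w.length) (j : I) :
    act A w (Pi.single j 1) ≤ 0 := by
  refine (hA.nonneg_or_nonpos_of_form_eq_two (hA.form_act_single w j)).resolve_left fun h ↦ ?_
  suffices IsReducedWord A (w ++ [j]) by
    have := hmax _ this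
    simp at this
  intro l hl
  have hne : act A w (Pi.single j 1) ≠ 0 := by
    intro h0
    have := hA.form_act_single w j
    simp [h0, form] at this
  have hneg : ¬ 0 ≤ act A l (Pi.single j 1) := by
    intro h'
    simp [hl, hA.reflection_single] at h'
    exact hne (le_antisymm h' h)
  obtain ⟨l', hl1, hl2⟩ := hA.exchange l j hneg
  have := hw l' (by simp [hl2, hl, mul_assoc, hA.reflection_mul_self])
  simp
  omega

/-- The longest element sends every nonnegative vector to a nonpositive one. -/
lemma act_nonpos_of_longest {A : Matrix I I ℤ} (hA : IsSimplyLacedCartan A)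
    {w : List I} (hw : IsReducedWord A w)
    (hmax : ∀ l, IsReducedWord A l → l.length ≤ w.length) {v : I → ℤ} (hv : 0 ≤ v) :
    act A w v ≤ 0 := by
  have hx : v = ∑ i, v i • Pi.single i 1 := by
    ext k
    simp [Finset.sum_apply, Pi.single_apply]
  rw [hx, map_sum]
  refine Finset.sum_nonpos fun i _ ↦ ?_
  rw [map_smul]
  exact smul_nonpos_of_nonneg_of_nonpos (hv i) (act_single_nonpos_of_longest hA hw hmax i)

/-- The bound on entries, for a set of labelled reduced words of the longest element
that is stable under braid moves. -/
lemma label_le_of_stable {A : Matrix I I ℤ} (hA : IsSimplyLacedCartan A) (n : ℕ)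
    (C : List (I × ℤ) → Prop)
    (hred : ∀ x, C x → IsReducedWord A (x.map Prod.fst))
    (hmax : ∀ x, C x → ∀ l, IsReducedWord A l → l.length ≤ x.length)
    (hmove : ∀ x y, C x → BraidMove A x y → C y)
    (hnonneg : ∀ x, C x → ∀ e ∈ x, 0 ≤ e.2)
    (hfst : ∀ i a S, C ((i, a) :: S) → a ≤ n)
    (P S : List (I × ℤ)) (j : I) (b : ℤ) (hC : C (P ++ (j, b) :: S)) :
    b ≤ 2 ^ P.length * n := by
  have hstable : ∀ x y, C x → Relation.ReflTransGen (BraidMove A) x y → C y := by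
    intro x y hx h
    induction h with
    | refl => exact hx
    | tail _ h ih => exact hmove _ _ ih h
  induction hk : P.length using Nat.strong_induction_on generalizing P S j b with
  | _ k ih =>
    rcases List.eq_nil_or_concat' P with rfl | ⟨P, ⟨i, a⟩, rfl⟩
    · simp only [List.length_nil] at hk
      subst hk
      simpa using hfst _ _ _ hC
    have hk' : k = P.length + 1 := by simpa using hk.symm
    have hn : (0 : ℤ) ≤ 2 ^ P.length * n := by positivity
    have hpow : (2 : ℤ) ^ k * n = 2 * (2 ^ P.length * n) := by rw [hk', pow_succ]; ring
    simp only [List.append_assoc, List.cons_append, List.nil_append] at hC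
    have hR := hred _ hC
    have hRij : IsReducedWord A [i, j] := by
      have : P.map Prod.fst ++ ([i, j] ++ S.map Prod.fst) =
        (P ++ (i, a) :: (j, b) :: S).map Prod.fst := by simp
      rw [← this] at hR
      exact hR.of_append_right.of_append_left
    have hij : i ≠ j := by
      rintro rfl
      have := hRij [] (by simp [hA.reflection_mul_self])
      simp at this
    rcases hA.offDiag i j hij with h0 | h1
    · have hm := BraidMove.comm P S i j a b h0
      have := ih P.length (by omega) P ((i, a) :: S) j b
        (by simpa using hmove _ _ (by simpa using hC) hm) rfl
      linarith
    by_cases hj : 0 ≤ act A (P.map Prod.fst) (Pi.single j 1)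
    · have hRS : IsReducedWord A (S.map Prod.fst) := by
        have : P.map Prod.fst ++ ([i, j] ++ S.map Prod.fst) =
          (P ++ (i, a) :: (j, b) :: S).map Prod.fst := by simp
        rw [← this] at hR
        exact hR.of_append_right.of_append_right
      have hS : ¬ 0 ≤ act A (S.map Prod.fst).reverse (Pi.single i 1) := by
        intro h
        have hw := act_nonpos_of_longest hA hR (by simpa using hmax _ hC) h
        have e := congrArg (fun f ↦ f (Pi.single i 1)) (hA.act_mul_act_reverse (S.map Prod.fst))
        simp only [Module.End.mul_apply, Module.End.one_apply] at e
        have hv : act A ((P ++ (i, a) :: (j, b) :: S).map Prod.fst)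
            (act A (S.map Prod.fst).reverse (Pi.single i 1)) =
            act A (P.map Prod.fst) (Pi.single j 1) := by
          simp [e, IsSimplyLacedCartan.reflection_single_of_ne, hA.reflection_single,
            hA.symm j i, h1]
        rw [hv] at hw
        have h2 := hA.form_act_single (P.map Prod.fst) j
        rw [le_antisymm hw hj] at h2
        simp [form] at h2
      obtain ⟨T, c, hT⟩ := exists_reflTransGen_cons hA S hRS i hS
      have hC1 := hstable _ _ hC (by
        simpa using reflTransGen_braidMove_append hT (P ++ [(i, a), (j, b)]) [])
      have hC2 := hmove _ _ (by simpa using hC1) (BraidMove.braid P T i j a b c h1)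
      have hb := ih P.length (by omega) P _ j (b + c - min a c) (by simpa using hC2) rfl
      have := min_le_right a c
      linarith
    · have hRP : IsReducedWord A (P.map Prod.fst) := by
        rw [List.map_append] at hR
        exact hR.of_append_left
      obtain ⟨Q, c, hQ⟩ := exists_reflTransGen_concat hA P hRP j hj
      have hlen := (hRP.of_reflTransGen hA hQ).2.1
      simp only [List.length_append, List.length_cons, List.length_nil] at hlen
      have hC1 := hstable _ _ hC (by
        simpa using reflTransGen_braidMove_append hQ [] ((i, a) :: (j, b) :: S))
      have hC2 := hmove _ _ (by simpa using hC1)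
        (BraidMove.braid Q S j i c a b (hA.symm i j ▸ h1))
      have hb1 := ih Q.length (by omega) Q _ i (a + b - min c b) (by simpa using hC2) rfl
      have hb2 := ih Q.length (by omega) Q _ j c (by simpa using hC1) rfl
      have ha : 0 ≤ a := hnonneg _ hC (i, a) (by simp)
      have := min_le_left c b
      have hQP : (2 : ℤ) ^ P.length * n = 2 * (2 ^ Q.length * n) := by
        rw [← hlen]; ring
      linarith

/-- The pair of sequences underlying a labelled word of length `ν`. -/
def toPair {ν : ℕ} (x : List (I × ℤ)) (h : x.length = ν) : (Fin ν → I) × (Fin ν → ℤ) :=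
  (fun k ↦ (x[(k : ℕ)]'(h ▸ k.2)).1, fun k ↦ (x[(k : ℕ)]'(h ▸ k.2)).2)

lemma ofFn_toPair_fst {ν : ℕ} (x : List (I × ℤ)) (h : x.length = ν) :
    List.ofFn (toPair x h).1 = x.map Prod.fst := by
  apply List.ext_getElem <;> simp [toPair, h]

lemma toPair_ofFn {ν : ℕ} (q : (Fin ν → I) × (Fin ν → ℤ)) :
    toPair (List.ofFn fun k ↦ (q.1 k, q.2 k)) (by simp) = q := by
  simp [toPair]

lemma toPair_mem_redWord_iff {A : Matrix I I ℤ} {w : List I} {ν : ℕ} (x : List (I × ℤ))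
    (h : x.length = ν) :
    (toPair x h).1 ∈ RedWord A (w.map (sE A)).prod ν ↔ act A (x.map Prod.fst) = act A w := by
  rw [RedWord, Set.mem_ofPred_eq, ofFn_toPair_fst, prod_sE_eq_iff]

lemma BraidMove.tAdjacent {A : Matrix I I ℤ} {w₀ : Function.End (I → ℤ)} {ν : ℕ}
    {x y : List (I × ℤ)} (h : BraidMove A x y) (hx : x.length = ν) (hy : y.length = ν)
    (hxw : (toPair x hx).1 ∈ RedWord A w₀ ν) (hyw : (toPair y hy).1 ∈ RedWord A w₀ ν) :
    TAdjacent A w₀ ν (toPair x hx) (toPair y hy) := by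
  refine ⟨hxw, hyw, ?_⟩
  cases h with
  | braid P S i j a b c h =>
    simp only [List.length_append, List.length_cons, List.length_nil] at hx
    refine Or.inl ⟨P.length, by omega, by omega, by omega, ?_⟩
    simp only [toPair, List.append_assoc, List.cons_append, List.nil_append]
    refine ⟨by simpa using h, by simp, by simp, by simp, by simp, ?_, by simp, by simp, by simp⟩
    intro k h0 h1 h2
    rcases lt_or_ge (k : ℕ) P.length with hk | hk
    · simp [List.getElem_append_left hk]
    · obtain ⟨m, hm⟩ : ∃ m, (k : ℕ) = P.length + (m + 3) := ⟨k - P.length - 3, by omega⟩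
      simp [hm]
  | comm P S i j a b h =>
    simp only [List.length_append, List.length_cons, List.length_nil] at hx
    refine Or.inr ⟨P.length, by omega, by omega, ?_⟩
    simp only [toPair, List.append_assoc, List.cons_append, List.nil_append]
    refine ⟨by simpa using h, by simp, by simp, ?_, by simp, by simp⟩
    intro k h0 h1
    rcases lt_or_ge (k : ℕ) P.length with hk | hk
    · simp [List.getElem_append_left hk]
    · obtain ⟨m, hm⟩ : ∃ m, (k : ℕ) = P.length + (m + 2) := ⟨k - P.length - 2, by omega⟩
      simp [hm]

lemma TAdjacent.eqvGen_mem_redWord_iff {A : Matrix I I ℤ} {w₀ : Function.End (I → ℤ)} {ν : ℕ}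
    {p q : (Fin ν → I) × (Fin ν → ℤ)} (h : Relation.EqvGen (TAdjacent A w₀ ν) p q) :
    p.1 ∈ RedWord A w₀ ν ↔ q.1 ∈ RedWord A w₀ ν := by
  induction h with
  | rel _ _ h => exact iff_of_true h.1 h.2.1
  | refl _ => rfl
  | symm _ _ _ ih => exact ih.symm
  | trans _ _ _ _ _ ih₁ ih₂ => exact ih₁.trans ih₂

lemma len_le {A : Matrix I I ℤ} (l : List I) : len A (l.map (sE A)).prod ≤ l.length :=
  Nat.sInf_le ⟨l, rfl, rfl⟩

lemma IsReducedWord.len_eq {A : Matrix I I ℤ} {l : List I} (h : IsReducedWord A l) :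
    len A (l.map (sE A)).prod = l.length := by
  refine le_antisymm (len_le l) (le_csInf ⟨_, l, rfl, rfl⟩ ?_)
  rintro m ⟨l', rfl, hl'⟩
  exact h l' ((prod_sE_eq_iff A l' l).1 hl')

/-- Lemma A.2: if the equivalence class of `p` lies in `𝒰_ℕ^n`
(all representatives have nonnegative entries, with first entry `≤ n`), then
every representative satisfies `a_k ≤ 2^{k-1} n` (`k` is `0`-indexed below). -/
theorem entries_bounded (A : Matrix I I ℤ) (hA : IsSimplyLacedCartan A)
    (w₀ : Function.End (I → ℤ)) (ν : ℕ) (hw : IsLongest A w₀ ν)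
    (n : ℕ) (p : (Fin ν → I) × (Fin ν → ℤ)) (hp : p.1 ∈ RedWord A w₀ ν)
    (hcl : ∀ q, Relation.EqvGen (TAdjacent A w₀ ν) p q →
      (∀ k : Fin ν, 0 ≤ q.2 k) ∧ (∀ k : Fin ν, (k : ℕ) = 0 → q.2 k ≤ n)) :
    ∀ q, Relation.EqvGen (TAdjacent A w₀ ν) p q →
      ∀ k : Fin ν, q.2 k ≤ 2 ^ (k : ℕ) * n := by
  obtain ⟨w, rfl⟩ := hw.mem
  intro q hq k
  let C : List (I × ℤ) → Prop := fun x ↦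
    ∃ h : x.length = ν, Relation.EqvGen (TAdjacent A (w.map (sE A)).prod ν) p (toPair x h)
  have hact : ∀ x, C x → act A (x.map Prod.fst) = act A w := by
    rintro x ⟨h, hx⟩
    exact (toPair_mem_redWord_iff x h).1 ((TAdjacent.eqvGen_mem_redWord_iff hx).1 hp)
  have hred : ∀ x, C x → IsReducedWord A (x.map Prod.fst) := by
    intro x hx l hl
    have h := len_le (A := A) l
    rw [(prod_sE_eq_iff A l w).2 (hl.trans (hact x hx)), hw.len_eq] at h
    simpa [hx.1] using h
  have hmax : ∀ x, C x → ∀ l, IsReducedWord A l → l.length ≤ x.length := by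
    intro x hx l hl
    rw [hx.1, ← hl.len_eq]
    exact hw.longest _ ⟨l, rfl⟩
  have hmove : ∀ x y, C x → BraidMove A x y → C y := by
    intro x y hx hxy
    have hy : y.length = ν := hxy.length_eq.trans hx.1
    refine ⟨hy, hx.2.trans _ _ _ (.rel _ _ (hxy.tAdjacent hx.1 hy ?_ ?_))⟩
    · exact (toPair_mem_redWord_iff x hx.1).2 (hact x hx)
    · exact (toPair_mem_redWord_iff y hy).2 ((hxy.act_eq hA).trans (hact x hx))
  have hnonneg : ∀ x, C x → ∀ e ∈ x, 0 ≤ e.2 := by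
    rintro x ⟨h, hx⟩ e he
    obtain ⟨m, hm, rfl⟩ := List.mem_iff_getElem.1 he
    exact (hcl _ hx).1 ⟨m, h ▸ hm⟩
  have hfst : ∀ i a S, C ((i, a) :: S) → a ≤ n := by
    rintro i a S ⟨h, hx⟩
    exact (hcl _ hx).2 ⟨0, by simp [← h]⟩ rfl
  set L : List (I × ℤ) := List.ofFn fun m ↦ (q.1 m, q.2 m) with hL
  have hkL : (k : ℕ) < L.length := by simp [hL]
  have hCL : C L := ⟨by simp [hL], by rw [toPair_ofFn]; exact hq⟩
  have hsplit : L.take k ++ (q.1 k, q.2 k) :: L.drop (k + 1) = L := by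
    have hk : L[(k : ℕ)] = (q.1 k, q.2 k) := by simp [hL]
    rw [← hk, List.getElem_cons_drop, List.take_append_drop]
  have := label_le_of_stable hA n C hred hmax hmove hnonneg hfst _ _ _ _ (hsplit.symm ▸ hCL)
  simpa [min_eq_left hkL.le] using this

end Lusztig
end
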